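/- arXiv:1609.07579 — 9 statements merged into one kernel-verified Lean document; each statement's English description precedes it below -/
import Mathlib

section
/- Under the stated hypotheses, the intertwining relation XΘ₂ = Θ₁X holds. -/
open ContinuousLinearMap

/-- If `Θ₁` commutes with `N₁ = X X†`, `N₂ = X† X` is boundedly invertible and
`Θ₂ = N₂⁻¹ (X† Θ₁ X)`, then the intertwining relation `X Θ₂ = Θ₁ X` holds. -/
theorem stmt1 {H : Type*} [NormedAddCommGroup H] [InnerProductSpace ℂ H] [CompleteSpace H]
    (X Θ₁ N₂inv : H →L[ℂ] H)
    (hcomm : Θ₁ * (X * adjoint X) = (X * adjoint X) * Θ₁)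
    (hleft : N₂inv * (adjoint X * X) = 1)
    (hright : (adjoint X * X) * N₂inv = 1)
    (Θ₂ : H →L[ℂ] H)
    (hΘ₂ : Θ₂ = N₂inv * (adjoint X * Θ₁ * X)) :
    X * Θ₂ = Θ₁ * X := by
  have key : Θ₁ * X = X * adjoint X * Θ₁ * X * N₂inv := by
    calc Θ₁ * X = Θ₁ * X * ((adjoint X * X) * N₂inv) := by rw [hright, mul_one]
      _ = Θ₁ * (X * adjoint X) * X * N₂inv := by simp only [mul_assoc]
      _ = X * adjoint X * Θ₁ * X * N₂inv := by rw [hcomm]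
  calc X * Θ₂ = X * N₂inv * adjoint X * (Θ₁ * X) := by rw [hΘ₂]; simp only [mul_assoc]
    _ = X * (N₂inv * (adjoint X * X)) * adjoint X * Θ₁ * X * N₂inv := by
      rw [key]; simp only [mul_assoc]
    _ = Θ₁ * X := by rw [hleft, mul_one, key]
end

section
/- Under the stated hypotheses, the second intertwining relation Θ₂X† = X†Θ₁ holds. -/
open ContinuousLinearMap

/-- If `Θ₁` commutes with `N₁ = X X†`, `N₂ = X† X` is boundedly invertible and
`Θ₂ = N₂⁻¹ (X† Θ₁ X)`, then the second intertwining relation `Θ₂ X† = X† Θ₁` holds. -/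
theorem stmt2 {H : Type*} [NormedAddCommGroup H] [InnerProductSpace ℂ H] [CompleteSpace H]
    (X Θ₁ N₂inv : H →L[ℂ] H)
    (hcomm : Θ₁ * (X * adjoint X) = (X * adjoint X) * Θ₁)
    (hleft : N₂inv * (adjoint X * X) = 1)
    (hright : (adjoint X * X) * N₂inv = 1)
    (Θ₂ : H →L[ℂ] H)
    (hΘ₂ : Θ₂ = N₂inv * (adjoint X * Θ₁ * X)) :
    Θ₂ * adjoint X = adjoint X * Θ₁ := by
  calc Θ₂ * adjoint X = N₂inv * adjoint X * (Θ₁ * (X * adjoint X)) := by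
        simp only [hΘ₂, mul_assoc]
    _ = N₂inv * (adjoint X * X) * (adjoint X * Θ₁) := by
        simp only [hcomm, mul_assoc]
    _ = adjoint X * Θ₁ := by rw [hleft, one_mul]
end

section
/- Under the stated hypotheses, if φ ∈ H and ε ∈ ℂ satisfy Θ₁φ = εφ, then Θ₂(X†φ) = ε·(X†φ); in particular, if moreover X†φ ≠ 0, then X†φ is an eigenvector of Θ₂ with the same eigenvalue ε. -/
open ContinuousLinearMap

/-- If `Θ₁ φ = ε φ`, then `Θ₂ (X† φ) = ε (X† φ)`; in particular, if `X† φ ≠ 0`,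
then `X† φ` is an eigenvector of `Θ₂` with the same eigenvalue `ε`. -/
theorem stmt3 {H : Type*} [NormedAddCommGroup H] [InnerProductSpace ℂ H] [CompleteSpace H]
    (X Θ₁ N₂inv : H →L[ℂ] H)
    (hcomm : Θ₁ * (X * adjoint X) = (X * adjoint X) * Θ₁)
    (hleft : N₂inv * (adjoint X * X) = 1)
    (hright : (adjoint X * X) * N₂inv = 1)
    (Θ₂ : H →L[ℂ] H)
    (hΘ₂ : Θ₂ = N₂inv * (adjoint X * Θ₁ * X))
    (φ : H) (ε : ℂ) (hφ : Θ₁ φ = ε • φ) :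
    Θ₂ (adjoint X φ) = ε • (adjoint X φ) ∧
      (adjoint X φ ≠ 0 →
        Module.End.HasEigenvector (Θ₂ : H →ₗ[ℂ] H) ε (adjoint X φ)) := by
  have intertwine : Θ₂ * adjoint X = adjoint X * Θ₁ := by
    calc Θ₂ * adjoint X = N₂inv * adjoint X * (Θ₁ * (X * adjoint X)) := by
          rw [hΘ₂]; simp only [mul_assoc]
      _ = N₂inv * (adjoint X * X) * (adjoint X * Θ₁) := by
          rw [hcomm]; simp only [mul_assoc]
      _ = adjoint X * Θ₁ := by rw [hleft, one_mul]
  have heigen : Θ₂ (adjoint X φ) = ε • adjoint X φ := by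
    calc Θ₂ (adjoint X φ) = adjoint X (Θ₁ φ) := DFunLike.congr_fun intertwine φ
      _ = ε • adjoint X φ := by rw [hφ, map_smul]
  exact ⟨heigen, fun hne => ⟨Module.End.mem_eigenspace_iff.mpr heigen, hne⟩⟩
end

section
/- (Proposition 1(i)) Under the stated hypotheses, N₂ commutes with Θ₂: N₂Θ₂ = Θ₂N₂. -/
open ContinuousLinearMap

/-- Proposition 1(i): `N₂` commutes with `Θ₂`. -/
theorem stmt4 {H : Type*} [NormedAddCommGroup H] [InnerProductSpace ℂ H] [CompleteSpace H]
    (X Θ₁ N₂inv : H →L[ℂ] H)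
    (hcomm : Θ₁ * (X * adjoint X) = (X * adjoint X) * Θ₁)
    (hleft : N₂inv * (adjoint X * X) = 1)
    (hright : (adjoint X * X) * N₂inv = 1)
    (Θ₂ : H →L[ℂ] H)
    (hΘ₂ : Θ₂ = N₂inv * (adjoint X * Θ₁ * X)) :
    (adjoint X * X) * Θ₂ = Θ₂ * (adjoint X * X) := by
  have key : adjoint X * Θ₁ * X * (adjoint X * X) =
      (adjoint X * X) * (adjoint X * Θ₁ * X) :=
    calc adjoint X * Θ₁ * X * (adjoint X * X)
        = adjoint X * (Θ₁ * (X * adjoint X)) * X := by simp only [mul_assoc]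
      _ = (adjoint X * X) * (adjoint X * Θ₁ * X) := by rw [hcomm]; simp only [mul_assoc]
  rw [hΘ₂, ← mul_assoc, hright, one_mul, mul_assoc N₂inv, key, ← mul_assoc N₂inv, hleft, one_mul]
end

section
/- (Proposition 1(ii)) Under the stated hypotheses, if Θ₁ is self-adjoint (Θ₁† = Θ₁), then Θ₂ is self-adjoint (Θ₂† = Θ₂). -/
open ContinuousLinearMap

/-- Proposition 1(ii): if `Θ₁` is self-adjoint, then so is `Θ₂ = N₂⁻¹ (X† Θ₁ X)`. -/
theorem stmt5 {H : Type*} [NormedAddCommGroup H] [InnerProductSpace ℂ H] [CompleteSpace H]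
    (X Θ₁ N₂inv : H →L[ℂ] H)
    (hcomm : Θ₁ * (X * adjoint X) = (X * adjoint X) * Θ₁)
    (hleft : N₂inv * (adjoint X * X) = 1)
    (hright : (adjoint X * X) * N₂inv = 1)
    (Θ₂ : H →L[ℂ] H)
    (hΘ₂ : Θ₂ = N₂inv * (adjoint X * Θ₁ * X))
    (hsa : adjoint Θ₁ = Θ₁) :
    adjoint Θ₂ = Θ₂ := by
  simp only [← star_eq_adjoint] at *
  have hN : IsSelfAdjoint (star X * X) := IsSelfAdjoint.star_mul_self X
  have hM : star N₂inv = N₂inv := by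
    have h : star X * X * star N₂inv = 1 := by
      rw [← star_one (H →L[ℂ] H), ← hleft, star_mul, hN.star_eq]
    exact (left_inv_eq_right_inv hleft h).symm
  have hNA : Commute (star X * X) (star X * Θ₁ * X) := by
    calc star X * X * (star X * Θ₁ * X)
        = star X * (X * star X * Θ₁) * X := by simp only [mul_assoc]
      _ = star X * Θ₁ * X * (star X * X) := by rw [← hcomm]; simp only [mul_assoc]
  have hMA : N₂inv * (star X * Θ₁ * X) = star X * Θ₁ * X * N₂inv := by
    calc N₂inv * (star X * Θ₁ * X)
        = N₂inv * (star X * Θ₁ * X * (star X * X)) * N₂inv := by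
          simp only [mul_assoc] at hright ⊢
          rw [hright, mul_one]
      _ = star X * Θ₁ * X * N₂inv := by
          rw [← hNA.eq, ← mul_assoc N₂inv, hleft, one_mul]
  rw [hΘ₂, star_mul, hM, hMA]
  simp only [star_mul, star_star, hsa, mul_assoc]
end

section
/- (Proposition 1(iii)) Under the stated hypotheses, if additionally N₁ = XX† is invertible in the algebra of bounded operators on H and Θ₂ is self-adjoint (Θ₂† = Θ₂), then Θ₁ is self-adjoint (Θ₁† = Θ₁). -/
open ContinuousLinearMap

/-- Proposition 1(iii): if moreover `N₁ = X X†` is boundedly invertible and `Θ₂` is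
self-adjoint, then `Θ₁` is self-adjoint. -/
theorem stmt6 {H : Type*} [NormedAddCommGroup H] [InnerProductSpace ℂ H] [CompleteSpace H]
    (X Θ₁ N₂inv N₁inv : H →L[ℂ] H)
    (hcomm : Θ₁ * (X * adjoint X) = (X * adjoint X) * Θ₁)
    (hleft : N₂inv * (adjoint X * X) = 1)
    (hright : (adjoint X * X) * N₂inv = 1)
    (hleft' : N₁inv * (X * adjoint X) = 1)
    (hright' : (X * adjoint X) * N₁inv = 1)
    (Θ₂ : H →L[ℂ] H)
    (hΘ₂ : Θ₂ = N₂inv * (adjoint X * Θ₁ * X))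
    (hsa : adjoint Θ₂ = Θ₂) :
    adjoint Θ₁ = Θ₁ := by
  simp only [← star_eq_adjoint] at *
  have hcancel : ∀ A B : H →L[ℂ] H, X * star X * A = X * star X * B → A = B := fun A B h => by
    simpa only [← mul_assoc, hleft', one_mul] using congrArg (N₁inv * ·) h
  have hN₂ : star X * X * Θ₂ = star X * Θ₁ * X := by
    rw [hΘ₂, ← mul_assoc, hright, one_mul]
  have hX : X * Θ₂ = Θ₁ * X := hcancel _ _ <| by
    simpa only [mul_assoc] using congrArg (X * ·) hN₂
  have hconj : Θ₁ * (X * star X) = X * Θ₂ * star X := by rw [hX, mul_assoc]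
  refine hcancel _ _ ?_
  calc X * star X * star Θ₁ = star (Θ₁ * (X * star X)) := by simp
    _ = X * Θ₂ * star X := by rw [hconj]; simp [hsa, mul_assoc]
    _ = X * star X * Θ₁ := by rw [← hconj, hcomm]
end

section
/- Under the stated hypotheses, the adjoint of Θ₂ = N₂⁻¹(X†Θ₁X) is obtained by the same construction applied to Θ₁†: Θ₂† = N₂⁻¹(X†Θ₁†X). -/
open ContinuousLinearMap

/-- If `t` commutes with `x * y`, then `y * t * x` commutes with `y * x`. -/
theorem Commute.mul_mul_swap {M : Type*} [Semigroup M] {t x y : M} (h : Commute t (x * y)) :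
    Commute (y * t * x) (y * x) := by
  calc y * t * x * (y * x) = y * (t * (x * y)) * x := by simp only [mul_assoc]
    _ = y * (x * y * t) * x := by rw [h.eq]
    _ = y * x * (y * t * x) := by simp only [mul_assoc]

/-- A right inverse of a self-adjoint element is self-adjoint. -/
theorem IsSelfAdjoint.of_mul_eq_one {M : Type*} [Monoid M] [StarMul M] {a b : M}
    (ha : IsSelfAdjoint a) (hab : a * b = 1) : IsSelfAdjoint b := by
  have h : star b * a = 1 := by simpa [ha.star_eq] using congrArg star hab
  exact left_inv_eq_right_inv h hab

theorem star_inv_mul_star_mul_mul {M : Type*} [Monoid M] [StarMul M] {x t n : M}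
    (h : Commute t (x * star x)) (hleft : n * (star x * x) = 1)
    (hright : star x * x * n = 1) :
    star (n * (star x * t * x)) = n * (star x * star t * x) := by
  have hn : star n = n :=
    ((IsSelfAdjoint.star_mul_self x).of_mul_eq_one hright).star_eq
  have ht : Commute (star t) (x * star x) := by simpa using h.star_star
  have hc : Commute (star x * star t * x) n :=
    Commute.units_inv_right (u := ⟨star x * x, n, hright, hleft⟩) ht.mul_mul_swap
  rw [← hc.eq]
  simp [hn, mul_assoc]

/-- The adjoint of `Θ₂ = N₂⁻¹ (X† Θ₁ X)` is obtained by the same construction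
applied to `Θ₁†`: `Θ₂† = N₂⁻¹ (X† Θ₁† X)`. -/
theorem stmt8 {H : Type*} [NormedAddCommGroup H] [InnerProductSpace ℂ H] [CompleteSpace H]
    (X Θ₁ N₂inv : H →L[ℂ] H)
    (hcomm : Θ₁ * (X * adjoint X) = (X * adjoint X) * Θ₁)
    (hleft : N₂inv * (adjoint X * X) = 1)
    (hright : (adjoint X * X) * N₂inv = 1)
    (Θ₂ : H →L[ℂ] H)
    (hΘ₂ : Θ₂ = N₂inv * (adjoint X * Θ₁ * X)) :
    adjoint Θ₂ = N₂inv * (adjoint X * adjoint Θ₁ * X) := by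
  subst hΘ₂
  exact star_inv_mul_star_mul_mul hcomm hleft hright
end

section
/- Under the stated hypotheses, if ψ ∈ H and μ ∈ ℂ satisfy Θ₁†ψ = μψ, then Θ₂†(X†ψ) = μ·(X†ψ); in particular, if X†ψ ≠ 0, then X†ψ is an eigenvector of Θ₂† with eigenvalue μ. -/
open ContinuousLinearMap

/-- If `t` commutes with `x * y` and `n` is a two-sided inverse of `y * x`, then `x` intertwines
`n * (y * t * x)` and `t`. -/
theorem mul_inv_mul_conj_of_commute {M : Type*} [Monoid M] {x y t n : M}
    (hcomm : t * (x * y) = (x * y) * t) (hleft : n * (y * x) = 1) (hright : (y * x) * n = 1) :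
    x * (n * (y * t * x)) = t * x := by
  have hyx : (y * x) * (y * t * x) = (y * t * x) * (y * x) := by
    calc (y * x) * (y * t * x) = y * ((x * y) * t) * x := by simp only [mul_assoc]
      _ = (y * t * x) * (y * x) := by rw [← hcomm]; simp only [mul_assoc]
  have hn : n * (y * t * x) = (y * t * x) * n := by
    calc n * (y * t * x) = n * ((y * t * x) * (y * x)) * n := by
          rw [mul_assoc n, mul_assoc (y * t * x), hright, mul_one]
      _ = (y * t * x) * n := by rw [← hyx, ← mul_assoc n, hleft, one_mul]
  calc x * (n * (y * t * x)) = ((x * y) * t) * x * n := by rw [hn]; simp only [mul_assoc]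
    _ = t * x * ((y * x) * n) := by rw [← hcomm]; simp only [mul_assoc]
    _ = t * x := by rw [hright, mul_one]

/-- If `Θ₁† ψ = μ ψ`, then `Θ₂† (X† ψ) = μ (X† ψ)`; in particular, if `X† ψ ≠ 0`,
then `X† ψ` is an eigenvector of `Θ₂†` with eigenvalue `μ`. -/
theorem stmt9 {H : Type*} [NormedAddCommGroup H] [InnerProductSpace ℂ H] [CompleteSpace H]
    (X Θ₁ N₂inv : H →L[ℂ] H)
    (hcomm : Θ₁ * (X * adjoint X) = (X * adjoint X) * Θ₁)
    (hleft : N₂inv * (adjoint X * X) = 1)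
    (hright : (adjoint X * X) * N₂inv = 1)
    (Θ₂ : H →L[ℂ] H)
    (hΘ₂ : Θ₂ = N₂inv * (adjoint X * Θ₁ * X))
    (ψ : H) (μ : ℂ) (hψ : adjoint Θ₁ ψ = μ • ψ) :
    adjoint Θ₂ (adjoint X ψ) = μ • (adjoint X ψ) ∧
      (adjoint X ψ ≠ 0 →
        Module.End.HasEigenvector (adjoint Θ₂ : H →ₗ[ℂ] H) μ (adjoint X ψ)) := by
  have hintertwine : adjoint Θ₂ * adjoint X = adjoint X * adjoint Θ₁ := by
    have h := congrArg star (mul_inv_mul_conj_of_commute hcomm hleft hright)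
    rw [← hΘ₂] at h
    simpa only [star_mul, star_eq_adjoint] using h
  have heig : adjoint Θ₂ (adjoint X ψ) = μ • (adjoint X ψ) := by
    calc adjoint Θ₂ (adjoint X ψ) = adjoint X (adjoint Θ₁ ψ) := DFunLike.congr_fun hintertwine ψ
      _ = μ • (adjoint X ψ) := by rw [hψ, map_smul]
  exact ⟨heig, fun hne => ⟨Module.End.mem_eigenspace_iff.mpr heig, hne⟩⟩
end

section
/- Let X be an invertible bounded linear operator on a complex Hilbert space H (with bounded inverse X⁻¹), let Θ₁ be a bounded linear operator with Θ₁N₁ = N₁Θ₁ where N₁ = XX†. Suppose φ ∈ H, φ ≠ 0, ε ∈ ℂ, Θ₁φ = εφ, the ε-eigenspace of Θ₁ is one-dimensional (every g with Θ₁g = εg is a scalar multiple of φ), and X†φ ≠ 0. Then there exists a real number k > 0 such that X⁻¹φ = k·(X†φ), equivalently N₁φ = k⁻¹·φ. -/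
open ContinuousLinearMap

/-- Equations (23) and (24): if `X` is boundedly invertible, `Θ₁` commutes with
`N₁ = X X†`, `φ ≠ 0` is an eigenvector of `Θ₁` with eigenvalue `ε` whose eigenspace is
one-dimensional, and `X† φ ≠ 0`, then there is `k > 0` with `X⁻¹ φ = k (X† φ)`,
equivalently `N₁ φ = k⁻¹ φ`. -/
theorem stmt16 {H : Type*} [NormedAddCommGroup H] [InnerProductSpace ℂ H] [CompleteSpace H]
    (X Xinv Θ₁ : H →L[ℂ] H)
    (hXleft : Xinv * X = 1) (hXright : X * Xinv = 1)
    (hcomm : Θ₁ * (X * adjoint X) = (X * adjoint X) * Θ₁)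
    (φ : H) (hφne : φ ≠ 0) (ε : ℂ) (hφ : Θ₁ φ = ε • φ)
    (hsimple : ∀ g : H, Θ₁ g = ε • g → ∃ c : ℂ, g = c • φ)
    (hker : adjoint X φ ≠ 0) :
    ∃ k : ℝ, 0 < k ∧ Xinv φ = (k : ℂ) • (adjoint X φ) ∧
      (X * adjoint X) φ = ((k : ℂ))⁻¹ • φ := by
  obtain ⟨c, hc⟩ := hsimple ((X * adjoint X) φ) (by
    have h := DFunLike.congr_fun hcomm φ
    exact h.trans ((congrArg (X * adjoint X) hφ).trans (map_smul _ ε φ)))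
  have hφnorm : (‖φ‖ : ℂ) ≠ 0 := by simpa using hφne
  have hc_eq : c = ((‖adjoint X φ‖ ^ 2 / ‖φ‖ ^ 2 : ℝ) : ℂ) := by
    have h : inner ℂ φ (X (adjoint X φ)) = inner ℂ φ (c • φ) := congrArg (inner ℂ φ) hc
    rw [← adjoint_inner_left, inner_smul_right, inner_self_eq_norm_sq_to_K,
      inner_self_eq_norm_sq_to_K] at h
    push_cast
    rw [eq_div_iff (pow_ne_zero 2 hφnorm)]
    exact h.symm
  have hpos : 0 < ‖adjoint X φ‖ ^ 2 / ‖φ‖ ^ 2 :=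
    div_pos (pow_pos (norm_pos_iff.2 hker) 2) (pow_pos (norm_pos_iff.2 hφne) 2)
  have hc_ne : c ≠ 0 := by
    rw [hc_eq]
    exact_mod_cast hpos.ne'
  refine ⟨(‖adjoint X φ‖ ^ 2 / ‖φ‖ ^ 2)⁻¹, inv_pos.2 hpos, ?_, ?_⟩
  · rw [Complex.ofReal_inv, ← hc_eq, eq_inv_smul_iff₀ hc_ne, ← map_smul, ← hc]
    exact DFunLike.congr_fun hXleft (adjoint X φ)
  · rw [Complex.ofReal_inv, inv_inv, ← hc_eq, hc]
end
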